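/- For every iteration κ, every agent i, and every index j, the CBAA-M bid-list entry satisfies (w_i^κ)_j ≤ (w*)_j; i.e., no agent's entry at any position ever exceeds the j-th largest bid in the network. -/

import Mathlib

open scoped Classical

/-- Closed neighborhood of `i` in `G`. -/
noncomputable def closedNbhd {S : ℕ} (G : SimpleGraph (Fin S)) (i : Fin S) :
    Finset (Fin S) :=
  Finset.univ.filter (fun h => h = i ∨ G.Adj i h)

lemma self_mem_closedNbhd {S : ℕ} (G : SimpleGraph (Fin S)) (i : Fin S) :
    i ∈ closedNbhd G i := by simp [closedNbhd]

/-- CBAA-M Phase 1 (local auction) for agent `i`. -/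
noncomputable def phase1 {S : ℕ} (c : Fin S → ℝ) (i : Fin S)
    (vw : (Fin S → Option (Fin S)) × (Fin S → ℝ)) :
    (Fin S → Option (Fin S)) × (Fin S → ℝ) :=
  if h : (∃ j, vw.1 j = some i) ∨ ¬ (∃ j, vw.2 j < c i) then vw
  else
    have hne : (Finset.univ.filter (fun j => vw.2 j < c i)).Nonempty := by
      push_neg at h
      obtain ⟨j, hj⟩ := h.2
      exact ⟨j, by simp [hj]⟩
    let j := (Finset.univ.filter (fun j => vw.2 j < c i)).min' hne
    (Function.update vw.1 j (some i), Function.update vw.2 j (c i))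

/-- One full CBAA-M iteration (Phase 1 followed by the Phase 2 max-consensus). -/
noncomputable def cbaaStep {S : ℕ} (G : SimpleGraph (Fin S)) (c : Fin S → ℝ)
    (st : Fin S → (Fin S → Option (Fin S)) × (Fin S → ℝ)) :
    Fin S → (Fin S → Option (Fin S)) × (Fin S → ℝ) := fun i =>
  (fun j =>
      (phase1 c
        (Classical.choose ((closedNbhd G i).exists_max_image
          (fun h => (phase1 c h (st h)).2 j) ⟨i, self_mem_closedNbhd G i⟩))
        (st (Classical.choose ((closedNbhd G i).exists_max_image
          (fun h => (phase1 c h (st h)).2 j) ⟨i, self_mem_closedNbhd G i⟩)))).1 j,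
   fun j =>
      (closedNbhd G i).sup' ⟨i, self_mem_closedNbhd G i⟩
        (fun h => (phase1 c h (st h)).2 j))

/-- The CBAA-M iterates: at iteration `0` all winners lists are `none` and all
bid lists are `0`. -/
noncomputable def cbaaIter {S : ℕ} (G : SimpleGraph (Fin S)) (c : Fin S → ℝ) :
    ℕ → Fin S → (Fin S → Option (Fin S)) × (Fin S → ℝ)
  | 0 => fun _ => (fun _ => none, fun _ => (0 : ℝ))
  | (κ + 1) => cbaaStep G c (cbaaIter G c κ)

/-- A pair of winners list and bid list is *coherent* if every bid entry is either `0` or the bid of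
the agent recorded as winner there, and the positive bids are strictly decreasing. -/
structure Coherent {S : ℕ} (c : Fin S → ℝ)
    (vw : (Fin S → Option (Fin S)) × (Fin S → ℝ)) : Prop where
  eq_zero_or_bid : ∀ j, vw.2 j = 0 ∨ ∃ g, vw.2 j = c g ∧ vw.1 j = some g
  lt_of_lt : ∀ a b, a < b → 0 < vw.2 b → vw.2 b < vw.2 a

lemma Coherent.phase1 {S : ℕ} {c : Fin S → ℝ} (hpos : ∀ i, 0 < c i)
    (hinj : Function.Injective c) {vw : (Fin S → Option (Fin S)) × (Fin S → ℝ)}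
    (h : Coherent c vw) (i : Fin S) : Coherent c (phase1 c i vw) := by
  unfold _root_.phase1
  split_ifs with hc
  · exact h
  · push Not at hc
    dsimp only
    generalize_proofs hne
    set m := (Finset.univ.filter (fun j => vw.2 j < c i)).min' hne
    have hm : vw.2 m < c i := (Finset.mem_filter.1 (Finset.min'_mem _ hne)).2
    have hlow : ∀ a, a < m → c i < vw.2 a := by
      intro a ham
      have hle : c i ≤ vw.2 a := by
        by_contra! hlt
        exact absurd (Finset.min'_le _ a (by simpa using hlt)) (not_le.2 ham)
      refine hle.lt_of_ne fun heq => ?_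
      rcases h.eq_zero_or_bid a with h0 | ⟨g, hg, hv⟩
      · exact (hpos i).ne' (heq.trans h0)
      · exact hc.1 a (hv.trans (congrArg some (hinj (heq.trans hg)).symm))
    refine ⟨fun j => ?_, fun a b hab hb => ?_⟩
    · by_cases hj : j = m
      · subst hj
        exact Or.inr ⟨i, by simp, by simp⟩
      · simpa [Function.update_of_ne hj] using h.eq_zero_or_bid j
    · dsimp only at hb ⊢
      by_cases hbm : b = m
      · rw [hbm, Function.update_self, Function.update_of_ne (hbm ▸ hab).ne]
        exact hlow a (hbm ▸ hab)
      · rw [Function.update_of_ne hbm] at hb ⊢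
        have hba := h.lt_of_lt a b hab hb
        by_cases ham : a = m
        · rw [ham, Function.update_self]
          exact (ham ▸ hba).trans hm
        · rwa [Function.update_of_ne ham]

lemma Coherent.cbaaStep {S : ℕ} {c : Fin S → ℝ} (hpos : ∀ i, 0 < c i)
    (hinj : Function.Injective c) (G : SimpleGraph (Fin S))
    {st : Fin S → (Fin S → Option (Fin S)) × (Fin S → ℝ)}
    (h : ∀ i, Coherent c (st i)) (i : Fin S) : Coherent c (cbaaStep G c st i) := by
  have h' : ∀ k, Coherent c (_root_.phase1 c k (st k)) := fun k => (h k).phase1 hpos hinj k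
  refine ⟨fun j => ?_, fun a b hab hb => ?_⟩
  · unfold _root_.cbaaStep
    dsimp only
    generalize_proofs hne hex
    obtain ⟨hmem, hmax⟩ := hex.choose_spec
    rw [le_antisymm (Finset.sup'_le hne _ hmax)
      (Finset.le_sup' (fun k => (_root_.phase1 c k (st k)).2 j) hmem)]
    exact (h' hex.choose).eq_zero_or_bid j
  · unfold _root_.cbaaStep at hb ⊢
    dsimp only at hb ⊢
    obtain ⟨k, hk, hkb⟩ := Finset.exists_mem_eq_sup' ⟨i, self_mem_closedNbhd G i⟩
      (fun k => (_root_.phase1 c k (st k)).2 b)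
    rw [hkb] at hb ⊢
    exact ((h' k).lt_of_lt a b hab hb).trans_le
      (Finset.le_sup' (fun k => (_root_.phase1 c k (st k)).2 a) hk)

lemma coherent_cbaaIter {S : ℕ} {c : Fin S → ℝ} (hpos : ∀ i, 0 < c i)
    (hinj : Function.Injective c) (G : SimpleGraph (Fin S)) (κ : ℕ) (i : Fin S) :
    Coherent c (cbaaIter G c κ i) := by
  induction κ generalizing i with
  | zero => exact ⟨fun _ => Or.inl rfl, fun _ _ _ hb => absurd hb (lt_irrefl _)⟩
  | succ κ ih => exact Coherent.cbaaStep hpos hinj G ih i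

lemma Coherent.bid_le_sorted {S : ℕ} {c : Fin S → ℝ} (hpos : ∀ i, 0 < c i)
    {vw : (Fin S → Option (Fin S)) × (Fin S → ℝ)} (h : Coherent c vw)
    (σ : Equiv.Perm (Fin S)) (hσ : StrictAnti (fun j => c (σ j))) (j : Fin S) :
    vw.2 j ≤ c (σ j) := by
  induction j using WellFoundedLT.induction with
  | ind j ih =>
    rcases h.eq_zero_or_bid j with h0 | ⟨g, hg, -⟩
    · exact h0.trans_le (hpos _).le
    · obtain ⟨r, rfl⟩ := σ.surjective g
      by_contra! hlt
      have hrj : r < j := hσ.lt_iff_gt.1 (hg ▸ hlt)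
      have hr := ih r hrj
      rw [← hg] at hr
      exact (h.lt_of_lt r j hrj (hg ▸ hpos _)).not_ge hr

/-- No CBAA-M bid-list entry ever exceeds the corresponding
entry of the sorted bid vector `w*`: for every iteration `κ`, agent `i` and
position `j`, `(w_i^κ)_j ≤ (w*)_j`. -/
theorem cbaam_bids_le_sorted {S : ℕ} (hS : 1 ≤ S)
    (G : SimpleGraph (Fin S)) (hG : G.Connected)
    (c : Fin S → ℝ) (hpos : ∀ i, 0 < c i) (hinj : Function.Injective c)
    (σ : Equiv.Perm (Fin S)) (hσ : StrictAnti (fun j => c (σ j)))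
    (wstar : Fin S → ℝ) (hw : ∀ j, wstar j = c (σ j))
    (κ : ℕ) (i : Fin S) (j : Fin S) :
    (cbaaIter G c κ i).2 j ≤ wstar j := by
  rw [hw]
  exact (coherent_cbaaIter hpos hinj G κ i).bid_le_sorted hpos σ hσ j
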